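/- arXiv:1209.2088 — 2 statements merged into one kernel-verified Lean document; each statement's English description precedes it below -/
import Mathlib

section
/- Suppose p = p(n) = c·(log n)/n + ξ(n) where ξ(n) = o((log n)/n) and 0 < c < 1 is a fixed constant. Then |R| = n^{c+o(1)} asymptotically almost surely; that is, for every ε > 0, the probability that n^{c-ε} ≤ |R| ≤ n^{c+ε} tends to 1 as n → ∞. -/
open MeasureTheory Filter

/-- The Bernoulli measure on `Bool` with success probability `p` (clamped to `[0,1]`). -/
noncomputable def bernMeasure (p : ℝ) : Measure Bool :=
  (min (ENNReal.ofReal p) 1) • Measure.dirac true +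
    (1 - min (ENNReal.ofReal p) 1) • Measure.dirac false

instance (p : ℝ) : IsProbabilityMeasure (bernMeasure p) := by
  constructor
  simp [bernMeasure]

/-- The ordered directed random graph on `n` vertices `v_1, …, v_n` (0-indexed as `0, …, n-1`):
each entry `ω a b` (for `a < b`, the only relevant ones) is an independent Bernoulli(p)
indicator of the presence of the directed edge from vertex `a` to vertex `b`. -/
noncomputable def graphMeasure (n : ℕ) (p : ℝ) : Measure (Fin n → Fin n → Bool) :=
  Measure.pi fun _ => Measure.pi fun _ => bernMeasure p

/-- The directed edge relation of the graph `ω` : an edge from `a` to `b` (vertices named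
`0, …, n-1`, with vertex `k` standing for `v_{k+1}`) exists iff `a < b` and the
corresponding coordinate is `true`. -/
def EdgeRel (n : ℕ) (ω : Fin n → Fin n → Bool) (a b : ℕ) : Prop :=
  ∃ (ha : a < n) (hb : b < n), a < b ∧ ω ⟨a, ha⟩ ⟨b, hb⟩ = true

/-- Vertex `j` (i.e. `v_{j+1}`) is reachable from vertex `0` (i.e. `v_1`) by a directed path. -/
def Reachable (n : ℕ) (ω : Fin n → Fin n → Bool) (j : ℕ) : Prop :=
  Relation.ReflTransGen (EdgeRel n ω) 0 j

-- `RSet n ω` is `R`, the set of vertices reachable from `v_1` (including `v_1`).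
open Classical in
noncomputable def RSet (n : ℕ) (ω : Fin n → Fin n → Bool) : Finset ℕ :=
  (Finset.range n).filter fun j => Reachable n ω j

open ProbabilityTheory

instance (n : ℕ) (p : ℝ) : IsProbabilityMeasure (graphMeasure n p) := by
  unfold graphMeasure; infer_instance

/-- Exchanging rows and columns preserves the law of the edge indicators. -/
lemma graphMeasure_map_swap (n : ℕ) (p : ℝ) :
    (graphMeasure n p).map (fun ω b a => ω a b) = graphMeasure n p := by
  refine Measure.ext_of_singleton fun ω => ?_
  rw [Measure.map_apply (by fun_prop) (measurableSet_singleton _)]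
  have h : (fun (ω : Fin n → Fin n → Bool) b a => ω a b) ⁻¹' {ω} = {fun a b => ω b a} := by
    ext η
    simp only [Set.mem_preimage, Set.mem_singleton_iff, funext_iff]
    exact forall_comm
  rw [h]
  simp only [graphMeasure, Measure.pi_singleton]
  exact Finset.prod_comm

lemma graphMeasure_map_column (n : ℕ) (p : ℝ) (b : Fin n) :
    (graphMeasure n p).map (fun ω a => ω a b) = Measure.pi fun _ => bernMeasure p := by
  have h : (fun (ω : Fin n → Fin n → Bool) (a : Fin n) => ω a b) =
      Function.eval b ∘ fun (ω : Fin n → Fin n → Bool) b a => ω a b := rfl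
  rw [h, ← Measure.map_map (measurable_pi_apply b) (by fun_prop), graphMeasure_map_swap]
  exact (measurePreserving_eval (fun _ : Fin n => Measure.pi fun _ => bernMeasure p) b).map_eq

/-- The columns of the indicator array are independent. -/
lemma iIndepFun_column (n : ℕ) (p : ℝ) :
    iIndepFun (fun (b : Fin n) (ω : Fin n → Fin n → Bool) (a : Fin n) => ω a b)
      (graphMeasure n p) := by
  rw [iIndepFun_iff_map_fun_eq_pi_map (fun b => (measurable_of_finite _).aemeasurable), graphMeasure_map_swap]
  simp only [graphMeasure_map_column]
  rfl

lemma pi_bernMeasure_real_forall_false {n : ℕ} {p : ℝ} (h0 : 0 ≤ p) (h1 : p ≤ 1)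
    (s : Finset (Fin n)) :
    (Measure.pi fun _ : Fin n => bernMeasure p).real {x | ∀ a ∈ s, x a = false} =
      (1 - p) ^ s.card := by
  classical
  have h : {x : Fin n → Bool | ∀ a ∈ s, x a = false} =
      Set.univ.pi fun a => if a ∈ s then {false} else Set.univ := by
    ext x
    simp only [Set.mem_ofPred_eq, Set.mem_pi, Set.mem_univ, true_imp_iff]
    refine forall_congr' fun a => ?_
    split_ifs with ha <;> simp [ha]
  have hf : bernMeasure p {false} = ENNReal.ofReal (1 - p) := by
    simp [bernMeasure, ENNReal.ofReal_sub _ h0, h1]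
  rw [h, measureReal_def, Measure.pi_pi]
  have : ∀ a, bernMeasure p (if a ∈ s then {false} else Set.univ) =
      if a ∈ s then ENNReal.ofReal (1 - p) else 1 := fun a => by
    split_ifs
    · exact hf
    · exact measure_univ
  simp only [this, ENNReal.toReal_prod]
  simp [h1, apply_ite ENNReal.toReal]

lemma reachable_iff {n : ℕ} {ω : Fin n → Fin n → Bool} {k : ℕ} :
    Reachable n ω k ↔ k = 0 ∨ ∃ a, Reachable n ω a ∧ EdgeRel n ω a k :=
  Relation.ReflTransGen.cases_tail_iff _ _ _

/-- Reachability of vertices below `k` depends only on the columns below `k`. -/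
lemma reachable_congr {n : ℕ} {ω η : Fin n → Fin n → Bool} (k : ℕ)
    (h : ∀ b : Fin n, (b : ℕ) < k → ∀ a, ω a b = η a b) {j : ℕ} (hj : j < k) :
    Reachable n ω j ↔ Reachable n η j := by
  induction j using Nat.strong_induction_on with
  | _ j ih =>
    rw [reachable_iff, reachable_iff (ω := η)]
    refine or_congr_right (exists_congr fun a => ?_)
    constructor
    · rintro ⟨hr, ha, hb, hab, he⟩
      exact ⟨(ih a hab (hab.trans hj)).1 hr, ha, hb, hab, h ⟨j, hb⟩ hj _ ▸ he⟩
    · rintro ⟨hr, ha, hb, hab, he⟩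
      exact ⟨(ih a hab (hab.trans hj)).2 hr, ha, hb, hab, (h ⟨j, hb⟩ hj _).symm ▸ he⟩

open Classical in
/-- The reachable vertices with index below `k`. -/
noncomputable def reachBelow (n k : ℕ) (ω : Fin n → Fin n → Bool) : Finset (Fin n) :=
  Finset.univ.filter fun j => (j : ℕ) < k ∧ Reachable n ω j

lemma mem_reachBelow {n k : ℕ} {ω : Fin n → Fin n → Bool} {j : Fin n} :
    j ∈ reachBelow n k ω ↔ (j : ℕ) < k ∧ Reachable n ω j := by
  simp [reachBelow]

lemma card_RSet (n : ℕ) (ω : Fin n → Fin n → Bool) :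
    (RSet n ω).card = (reachBelow n n ω).card := by
  classical
  have : RSet n ω = (reachBelow n n ω).map Fin.valEmbedding := by
    ext j
    simp only [RSet, Finset.mem_filter, Finset.mem_range, Finset.mem_map, mem_reachBelow,
      Fin.valEmbedding_apply]
    constructor
    · rintro ⟨h, hr⟩
      exact ⟨⟨j, h⟩, ⟨h, hr⟩, rfl⟩
    · rintro ⟨i, ⟨h, hr⟩, rfl⟩
      exact ⟨h, hr⟩
  rw [this, Finset.card_map]

lemma card_reachBelow_one {n : ℕ} (hn : 0 < n) (ω : Fin n → Fin n → Bool) :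
    (reachBelow n 1 ω).card = 1 := by
  rw [Finset.card_eq_one]
  refine ⟨⟨0, hn⟩, ?_⟩
  ext j
  simp only [mem_reachBelow, Finset.mem_singleton, Fin.ext_iff, Nat.lt_one_iff]
  refine ⟨And.left, fun h => ⟨h, ?_⟩⟩
  rw [h]
  exact Relation.ReflTransGen.refl

lemma one_le_card_reachBelow {n k : ℕ} (hn : 0 < n) (hk : 1 ≤ k) (ω : Fin n → Fin n → Bool) :
    1 ≤ (reachBelow n k ω).card := by
  rw [← card_reachBelow_one hn ω]
  refine Finset.card_le_card fun j hj => ?_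
  rw [mem_reachBelow] at hj ⊢
  exact ⟨hj.1.trans_le hk, hj.2⟩

open Classical in
lemma card_reachBelow_succ {n k : ℕ} (hk : k < n) (hk1 : 1 ≤ k) (ω : Fin n → Fin n → Bool) :
    (reachBelow n (k + 1) ω).card =
      if ∀ a ∈ reachBelow n k ω, ω a ⟨k, hk⟩ = false then (reachBelow n k ω).card
      else (reachBelow n k ω).card + 1 := by
  have hr : Reachable n ω k ↔ ¬ ∀ a ∈ reachBelow n k ω, ω a ⟨k, hk⟩ = false := by
    rw [reachable_iff]
    simp only [mem_reachBelow, not_forall, Bool.not_eq_false]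
    constructor
    · rintro (h | ⟨a, hr, ha, hb, hab, he⟩)
      · omega
      · exact ⟨⟨a, ha⟩, ⟨hab, hr⟩, he⟩
    · rintro ⟨a, ⟨hab, hr⟩, he⟩
      exact Or.inr ⟨a, hr, a.2, hk, hab, he⟩
  split_ifs with h
  · congr 1
    ext j
    simp only [mem_reachBelow]
    refine and_congr_left fun hj => ?_
    have : (j : ℕ) ≠ k := fun e => (hr.1 (e ▸ hj)) h
    omega
  · have h2 : reachBelow n (k + 1) ω = insert ⟨k, hk⟩ (reachBelow n k ω) := by
      ext j
      simp only [mem_reachBelow, Finset.mem_insert, Fin.ext_iff]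
      constructor
      · rintro ⟨hj, hjr⟩
        by_cases e : (j : ℕ) = k
        · exact Or.inl e
        · exact Or.inr ⟨by omega, hjr⟩
      · rintro (e | ⟨hj, hjr⟩)
        · exact ⟨by omega, e ▸ hr.2 h⟩
        · exact ⟨by omega, hjr⟩
    rw [h2, Finset.card_insert_of_notMem]
    simp [mem_reachBelow]

lemma indepFun_reachBelow_column {n : ℕ} (p : ℝ) {k : ℕ} (hk : k < n)
    [MeasurableSpace (Finset (Fin n))] [DiscreteMeasurableSpace (Finset (Fin n))] :
    IndepFun (reachBelow n k) (fun ω a => ω a ⟨k, hk⟩) (graphMeasure n p) := by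
  classical
  have h := (iIndepFun_column n p).indepFun_finset (Finset.univ.filter fun b : Fin n => (b : ℕ) < k)
    {⟨k, hk⟩} (by simp) (fun b => measurable_of_finite _)
  let S := Finset.univ.filter fun b : Fin n => (b : ℕ) < k
  let φ : (S → Fin n → Bool) → Finset (Fin n) := fun x =>
    reachBelow n k fun a b => if hb : b ∈ S then x ⟨b, hb⟩ a else false
  have h2 := h.comp (φ := φ) (ψ := fun x => x ⟨⟨k, hk⟩, by simp⟩) (measurable_of_finite _)
    (measurable_of_finite _)
  have e : reachBelow n k = φ ∘ fun ω (i : S) (a : Fin n) => ω a i := by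
    funext ω
    ext j
    simp only [Function.comp, φ, mem_reachBelow]
    refine and_congr_right fun hj => reachable_congr k (fun b hb a => ?_) hj
    simp [S, hb]
  rw [e]
  exact h2

lemma integral_card_reachBelow_succ {n : ℕ} {p : ℝ} (h0 : 0 ≤ p) (h1 : p ≤ 1) {k : ℕ}
    (hk : k < n) (hk1 : 1 ≤ k) (g : ℕ → ℝ) :
    ∫ ω, g (reachBelow n (k + 1) ω).card ∂graphMeasure n p =
      ∫ ω, (g ((reachBelow n k ω).card + 1) +
        (1 - p) ^ (reachBelow n k ω).card *
          (g (reachBelow n k ω).card - g ((reachBelow n k ω).card + 1))) ∂graphMeasure n p := by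
  classical
  let _ : MeasurableSpace (Finset (Fin n)) := ⊤
  let F : Finset (Fin n) × (Fin n → Bool) → ℝ := fun x =>
    g (x.1.card + 1) + {y : Fin n → Bool | ∀ a ∈ x.1, y a = false}.indicator 1 x.2 *
      (g x.1.card - g (x.1.card + 1))
  have hF : ∀ ω, g (reachBelow n (k + 1) ω).card =
      F (reachBelow n k ω, fun a => ω a ⟨k, hk⟩) := fun ω => by
    rw [card_reachBelow_succ hk hk1]
    simp only [F, Set.indicator_apply, Set.mem_ofPred_eq]
    split_ifs <;> simp
  have hm := (indepFun_iff_map_prod_eq_prod_map_map (measurable_of_finite _).aemeasurable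
    (measurable_of_finite _).aemeasurable).1 (indepFun_reachBelow_column p hk)
  simp only [hF]
  rw [← integral_map (φ := fun ω => (reachBelow n k ω, fun a => ω a ⟨k, hk⟩)) (f := F)
    (measurable_of_finite _).aemeasurable (measurable_of_finite _).aestronglyMeasurable, hm,
    graphMeasure_map_column, integral_prod _ (Integrable.of_finite),
    integral_map (measurable_of_finite _).aemeasurable
      (measurable_of_finite _).aestronglyMeasurable]
  refine integral_congr_ae (ae_of_all _ fun ω => ?_)
  simp only [F]
  rw [integral_add (integrable_const _) Integrable.of_finite, integral_mul_const,
    integral_indicator_one (Set.toFinite _).measurableSet, pi_bernMeasure_real_forall_false h0 h1]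
  simp

lemma integral_card_reachBelow_le {n : ℕ} {p : ℝ} (h0 : 0 ≤ p) (h1 : p ≤ 1) (hn : 1 ≤ n)
    (g : ℕ → ℝ) {r : ℝ} (hr : 0 ≤ r)
    (hg : ∀ x : ℕ, 1 ≤ x → g (x + 1) + (1 - p) ^ x * (g x - g (x + 1)) ≤ r * g x) :
    ∫ ω, g (RSet n ω).card ∂graphMeasure n p ≤ r ^ (n - 1) * g 1 := by
  have key : ∀ k, k + 1 ≤ n →
      ∫ ω, g (reachBelow n (k + 1) ω).card ∂graphMeasure n p ≤ r ^ k * g 1 := by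
    intro k
    induction k with
    | zero => intro _; simp [card_reachBelow_one hn]
    | succ k ih =>
      intro hk
      rw [integral_card_reachBelow_succ h0 h1 (by omega) (by omega)]
      calc _ ≤ ∫ ω, r * g (reachBelow n (k + 1) ω).card ∂graphMeasure n p :=
            integral_mono Integrable.of_finite Integrable.of_finite fun ω =>
              hg _ (one_le_card_reachBelow hn (by omega) ω)
        _ = r * ∫ ω, g (reachBelow n (k + 1) ω).card ∂graphMeasure n p := integral_const_mul _ _
        _ ≤ r * (r ^ k * g 1) := mul_le_mul_of_nonneg_left (ih (by omega)) hr
        _ = _ := by ring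
  have := key (n - 1) (by omega)
  rw [Nat.sub_add_cancel hn] at this
  simpa only [card_RSet] using this

lemma integral_card_RSet_le {n : ℕ} {p : ℝ} (h0 : 0 ≤ p) (h1 : p ≤ 1) (hn : 1 ≤ n) :
    ∫ ω, ((RSet n ω).card : ℝ) ∂graphMeasure n p ≤ (1 + p) ^ (n - 1) := by
  have := integral_card_reachBelow_le h0 h1 hn (fun x => (x : ℝ)) (r := 1 + p) (by linarith)
    fun x _ => by
      have hb := one_add_mul_le_pow (a := -p) (by linarith) x
      rw [← sub_eq_add_neg 1 p] at hb
      push_cast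
      linarith
  simpa using this

/-- Markov's inequality for the expected number of reachable vertices. -/
lemma measureReal_lt_card_RSet_le {n : ℕ} {p : ℝ} (h0 : 0 ≤ p) (h1 : p ≤ 1) (hn : 1 ≤ n) {m : ℝ}
    (hm : 0 < m) :
    (graphMeasure n p).real {ω | m < (RSet n ω).card} ≤ Real.exp (p * n) / m := by
  rw [le_div_iff₀' hm]
  calc m * (graphMeasure n p).real {ω | m < (RSet n ω).card}
      ≤ m * (graphMeasure n p).real {ω | m ≤ (RSet n ω).card} :=
        mul_le_mul_of_nonneg_left (measureReal_mono fun ω (h : m < _) => show m ≤ _ from h.le) hm.le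
    _ ≤ ∫ ω, ((RSet n ω).card : ℝ) ∂graphMeasure n p :=
        mul_meas_ge_le_integral_of_nonneg (ae_of_all _ fun ω => by positivity)
          Integrable.of_finite _
    _ ≤ (1 + p) ^ (n - 1) := integral_card_RSet_le h0 h1 hn
    _ ≤ (1 + p) ^ n := pow_le_pow_right₀ (by linarith) (by omega)
    _ ≤ Real.exp p ^ n := by
        refine pow_le_pow_left₀ (by linarith) ?_ n
        linarith [Real.add_one_le_exp p]
    _ = Real.exp (p * n) := by rw [← Real.exp_nat_mul, mul_comm]

lemma mul_div_le_one_sub_pow {p : ℝ} (h0 : 0 ≤ p) (h1 : p ≤ 1) (x : ℕ) :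
    x * p / (1 + x * p) ≤ 1 - (1 - p) ^ x := by
  have hx : 0 < 1 + x * p := by positivity
  have hq : 0 ≤ (1 - p) ^ x := pow_nonneg (by linarith) x
  have h2 : (1 - p) ^ x * (1 + x * p) ≤ 1 := by
    calc (1 - p) ^ x * (1 + x * p) ≤ (1 - p) ^ x * (1 + p) ^ x :=
          mul_le_mul_of_nonneg_left (one_add_mul_le_pow (by linarith) x) hq
      _ = ((1 - p) * (1 + p)) ^ x := (mul_pow _ _ _).symm
      _ ≤ 1 := pow_le_one₀ (mul_nonneg (by linarith) (by linarith)) (by nlinarith)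
  rw [div_le_iff₀ hx]
  linarith

lemma inv_sqrt_four_mul_add_one_le {x : ℝ} (hx : 1 ≤ x) :
    (√(4 * (x + 1) - 3))⁻¹ ≤ (√(4 * x - 3))⁻¹ * (1 - 1 / (2 * x)) := by
  have ha : 0 < 4 * x - 3 := by linarith
  have hb : 0 < 4 * (x + 1) - 3 := by linarith
  have hc : 0 ≤ 1 - 1 / (2 * x) := by
    rw [sub_nonneg, div_le_one (by linarith)]; linarith
  have hd : √(4 * x - 3) ≤ √(4 * (x + 1) - 3) * (1 - 1 / (2 * x)) := by
    refine Real.sqrt_le_iff.2 ⟨by positivity, ?_⟩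
    rw [mul_pow, Real.sq_sqrt hb.le]
    have : (4 * (x + 1) - 3) * (1 - 1 / (2 * x)) ^ 2 = 4 * x - 3 + 1 / (4 * x ^ 2) := by
      field_simp
      ring
    rw [this]
    have : 0 ≤ 1 / (4 * x ^ 2) := by positivity
    linarith
  have hsa := Real.sqrt_pos.2 ha
  have hsb := Real.sqrt_pos.2 hb
  rw [inv_mul_eq_div, le_div_iff₀ hsa, inv_mul_le_iff₀ hsb]
  exact hd

lemma measureReal_card_RSet_lt_le {n : ℕ} {p : ℝ} (h0 : 0 ≤ p) (h1 : p ≤ 1) (hn : 1 ≤ n) {m : ℝ}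
    (hm : 0 < m) :
    (graphMeasure n p).real {ω | (RSet n ω).card < m} ≤
      √(4 * m) * Real.exp (-(p * (n - 1) / (2 * (1 + m * p)))) := by
  classical
  set ρ := p / (2 * (1 + m * p)) with hρ
  have hρ0 : 0 ≤ ρ := by positivity
  have hρ1 : ρ ≤ 1 := by
    rw [hρ, div_le_one (by positivity)]
    nlinarith [mul_nonneg hm.le h0]
  let g : ℕ → ℝ := fun x => if (x : ℝ) ≤ m then (√(4 * (x : ℝ) - 3))⁻¹ else 0
  have hg0 : ∀ x, 0 ≤ g x := fun x => by
    simp only [g]; split_ifs <;> positivity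
  have hstep : ∀ x : ℕ, 1 ≤ x →
      g (x + 1) + (1 - p) ^ x * (g x - g (x + 1)) ≤ (1 - ρ) * g x := by
    intro x hx
    have hx' : (1 : ℝ) ≤ x := by exact_mod_cast hx
    by_cases hxm : (x : ℝ) ≤ m
    · have hgx : g x = (√(4 * (x : ℝ) - 3))⁻¹ := if_pos hxm
      have hgs : g (x + 1) ≤ g x * (1 - 1 / (2 * x)) := by
        rw [hgx]
        refine le_trans ?_ (inv_sqrt_four_mul_add_one_le hx')
        simp only [g]
        push_cast
        split_ifs
        · exact le_rfl
        · positivity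
      have hq1 : (1 - p) ^ x ≤ 1 := pow_le_one₀ (by linarith) (by linarith)
      have hd : 2 * x * ρ ≤ 1 - (1 - p) ^ x := by
        refine le_trans ?_ (mul_div_le_one_sub_pow h0 h1 x)
        have : 2 * x * ρ = x * p / (1 + m * p) := by rw [hρ]; field_simp
        rw [this]
        gcongr
      have h3 : ρ ≤ (1 - (1 - p) ^ x) * (1 / (2 * x)) := by
        rw [mul_one_div, le_div_iff₀ (by positivity)]; linarith
      have h4 := mul_le_mul_of_nonneg_left hgs (sub_nonneg.2 hq1)
      have h5 := mul_le_mul_of_nonneg_right h3 (hg0 x)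
      nlinarith
    · have hgx : g x = 0 := if_neg hxm
      have hgs : g (x + 1) = 0 := if_neg fun h => hxm (by push_cast at h; linarith)
      simp [hgx, hgs]
  have hint := integral_card_reachBelow_le h0 h1 hn g (r := 1 - ρ) (by linarith) hstep
  have hg1 : g 1 ≤ 1 := by
    simp only [g]
    split_ifs <;> norm_num
  have hs : 0 < √(4 * m) := Real.sqrt_pos.2 (by linarith)
  have hsub : {ω : Fin n → Fin n → Bool | ((RSet n ω).card : ℝ) < m} ⊆
      {ω | (√(4 * m))⁻¹ ≤ g (RSet n ω).card} := fun ω h => by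
    have h : ((RSet n ω).card : ℝ) < m := h
    have h1 : (1 : ℝ) ≤ (RSet n ω).card := by
      rw [card_RSet]
      exact_mod_cast one_le_card_reachBelow hn hn ω
    change _ ≤ g _
    simp only [g, if_pos h.le]
    have : 0 < √(4 * ((RSet n ω).card : ℝ) - 3) := Real.sqrt_pos.2 (by linarith)
    gcongr
    linarith
  have hmarkov : (√(4 * m))⁻¹ * (graphMeasure n p).real {ω | ((RSet n ω).card : ℝ) < m} ≤
      ∫ ω, g (RSet n ω).card ∂graphMeasure n p :=
    (mul_le_mul_of_nonneg_left (measureReal_mono hsub) (by positivity)).trans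
      (mul_meas_ge_le_integral_of_nonneg (ae_of_all _ fun ω => hg0 _) Integrable.of_finite _)
  rw [inv_mul_le_iff₀ hs] at hmarkov
  refine hmarkov.trans (mul_le_mul_of_nonneg_left (hint.trans ?_) hs.le)
  calc (1 - ρ) ^ (n - 1) * g 1 ≤ (1 - ρ) ^ (n - 1) :=
        mul_le_of_le_one_right (pow_nonneg (by linarith) _) hg1
    _ ≤ Real.exp (-ρ) ^ (n - 1) :=
        pow_le_pow_left₀ (by linarith) (Real.one_sub_le_exp_neg ρ) _
    _ = _ := by
        rw [← Real.exp_nat_mul, Nat.cast_sub hn]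
        congr 1
        rw [hρ]
        push_cast
        ring

open Asymptotics in
/-- If `p n = c·(log n)/n + ξ n` with `ξ = o((log n)/n)` and `0 < c < 1`
fixed, then `|R| = n^{c+o(1)}` a.a.s.: for every `ε > 0`, the probability that
`n^{c-ε} ≤ |R| ≤ n^{c+ε}` tends to `1` as `n → ∞`. -/
theorem reachable_card_aas_of_lt_one (c : ℝ) (hc0 : 0 < c) (hc1 : c < 1) (p ξ : ℕ → ℝ)
    (hξ : ξ =o[atTop] fun n : ℕ => Real.log n / n)
    (hp : ∀ n : ℕ, p n = c * Real.log n / n + ξ n)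
    (ε : ℝ) (hε : 0 < ε) :
    Tendsto (fun n : ℕ => graphMeasure n (p n)
        {ω | (n : ℝ) ^ (c - ε) ≤ ((RSet n ω).card : ℝ) ∧
             ((RSet n ω).card : ℝ) ≤ (n : ℝ) ^ (c + ε)})
      atTop (nhds 1) := by
  set u : ℕ → ℝ := fun n => p n / (Real.log n / n) with hu
  have hcast := tendsto_natCast_atTop_atTop (R := ℝ)
  have hn2 : ∀ᶠ n : ℕ in atTop, 2 ≤ n := eventually_ge_atTop 2
  have hpos : ∀ n : ℕ, 2 ≤ n → 0 < Real.log n := fun n hn =>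
    Real.log_pos (by exact_mod_cast hn)
  have hut : Tendsto u atTop (nhds c) := by
    have h := (hξ.tendsto_div_nhds_zero).const_add c
    rw [add_zero] at h
    refine h.congr' ?_
    filter_upwards [hn2] with n hn
    have h1 := (hpos n hn).ne'
    have h2 : (n : ℝ) ≠ 0 := by positivity
    simp only [hu, hp n]
    field_simp
  have hpu : ∀ n : ℕ, 2 ≤ n → p n = u n * (Real.log n / n) := fun n hn => by
    have h1 := (hpos n hn).ne'
    have h2 : (n : ℝ) ≠ 0 := by positivity
    simp only [hu]
    field_simp
  have hlog : ∀ r : ℝ, 0 < r → Tendsto (fun n : ℕ => Real.log n / (n : ℝ) ^ r) atTop (nhds 0) :=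
    fun r hr => (isLittleO_log_rpow_atTop hr).tendsto_div_nhds_zero.comp hcast
  have hmp : ∀ s : ℝ, s < 1 → Tendsto (fun n : ℕ => (n : ℝ) ^ s * p n) atTop (nhds 0) := by
    intro s hs
    have h := hut.mul (hlog (1 - s) (by linarith))
    rw [mul_zero] at h
    refine h.congr' ?_
    filter_upwards [hn2] with n hn
    have h2 : (0 : ℝ) < n := by positivity
    rw [hpu n hn, Real.rpow_sub h2, Real.rpow_one]
    field_simp
  have hp0 : ∀ᶠ n in atTop, 0 ≤ p n := by
    filter_upwards [hn2, hut.eventually_const_lt hc0] with n hn h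
    rw [hpu n hn]
    exact mul_nonneg h.le (div_nonneg (hpos n hn).le (by positivity))
  have hp1 : ∀ᶠ n in atTop, p n ≤ 1 := by
    have h := hmp 0 one_pos
    simp only [Real.rpow_zero, one_mul] at h
    exact h.eventually_le_const one_pos
  have hvt : Tendsto (fun n : ℕ => u n * (1 - (n : ℝ)⁻¹) / (1 + (n : ℝ) ^ (c - ε) * p n))
      atTop (nhds c) := by
    have h1 := (tendsto_inv_atTop_zero.comp hcast).const_sub 1
    have h2 := (hmp (c - ε) (by linarith)).const_add 1
    have h := (hut.mul h1).div h2 (by norm_num)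
    simp only [add_zero, sub_zero, mul_one, div_one] at h
    exact h
  have hup : ∀ᶠ n : ℕ in atTop,
      (graphMeasure n (p n)).real {ω | (n : ℝ) ^ (c + ε) < (RSet n ω).card} ≤
        (n : ℝ) ^ (-(ε / 2)) := by
    filter_upwards [hn2, hp0, hp1, hut.eventually_lt_const (show c < c + ε / 2 by linarith)]
      with n hn h0 h1 h
    have hn0 : (0 : ℝ) < n := by positivity
    refine (measureReal_lt_card_RSet_le h0 h1 (by omega) (Real.rpow_pos_of_pos hn0 _)).trans ?_
    rw [div_le_iff₀ (Real.rpow_pos_of_pos hn0 _), ← Real.rpow_add hn0,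
      Real.rpow_def_of_pos hn0]
    refine Real.exp_le_exp.2 ?_
    have e : p n * n = u n * Real.log n := by
      rw [hpu n hn]; field_simp
    rw [e]
    nlinarith [hpos n hn]
  have hlow : ∀ᶠ n : ℕ in atTop,
      (graphMeasure n (p n)).real {ω | (RSet n ω).card < (n : ℝ) ^ (c - ε)} ≤
        2 * (n : ℝ) ^ (-(ε / 4)) := by
    filter_upwards [hn2, hp0, hp1, hvt.eventually_const_lt (show c - ε / 2 < c by linarith)]
      with n hn h0 h1 h
    have hn0 : (0 : ℝ) < n := by positivity
    have hm0 := Real.rpow_pos_of_pos hn0 (c - ε)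
    refine (measureReal_card_RSet_lt_le h0 h1 (by omega) hm0).trans ?_
    have e : p n * (n - 1) / (2 * (1 + (n : ℝ) ^ (c - ε) * p n)) =
        u n * (1 - (n : ℝ)⁻¹) / (1 + (n : ℝ) ^ (c - ε) * p n) * (Real.log n / 2) := by
      have : 0 < 1 + (n : ℝ) ^ (c - ε) * p n := by positivity
      have e1 : p n * (n - 1) = u n * (1 - (n : ℝ)⁻¹) * Real.log n := by
        rw [hpu n hn]; field_simp
      rw [e1]
      field_simp
    have hs : √(4 * (n : ℝ) ^ (c - ε)) = 2 * (n : ℝ) ^ ((c - ε) / 2) := by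
      rw [show (4 : ℝ) * (n : ℝ) ^ (c - ε) = (2 * (n : ℝ) ^ ((c - ε) / 2)) ^ 2 by
        rw [mul_pow, ← Real.rpow_natCast ((n : ℝ) ^ ((c - ε) / 2)), ← Real.rpow_mul hn0.le]
        norm_num]
      exact Real.sqrt_sq (by positivity)
    rw [hs, mul_assoc, e]
    refine mul_le_mul_of_nonneg_left ?_ zero_le_two
    rw [Real.rpow_def_of_pos hn0 ((c - ε) / 2), Real.rpow_def_of_pos hn0 (-(ε / 4)),
      ← Real.exp_add]
    refine Real.exp_le_exp.2 ?_
    have := mul_le_mul_of_nonneg_right h.le (half_pos (hpos n hn)).le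
    linarith
  have hlim : Tendsto (fun n : ℕ => ENNReal.ofReal
      (1 - ((n : ℝ) ^ (-(ε / 2)) + 2 * (n : ℝ) ^ (-(ε / 4))))) atTop (nhds 1) := by
    have h1 := (tendsto_rpow_neg_atTop (half_pos hε)).comp hcast
    have h2 := ((tendsto_rpow_neg_atTop (show 0 < ε / 4 by linarith)).comp hcast).const_mul 2
    simpa using ENNReal.tendsto_ofReal ((h1.add h2).const_sub 1)
  refine tendsto_of_tendsto_of_tendsto_of_le_of_le' hlim tendsto_const_nhds ?_
    (Eventually.of_forall fun n => prob_le_one)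
  filter_upwards [hup, hlow] with n h1 h2
  refine ENNReal.ofReal_le_of_le_toReal ?_
  rw [← measureReal_def]
  have hc : {ω : Fin n → Fin n → Bool | (n : ℝ) ^ (c - ε) ≤ ((RSet n ω).card : ℝ) ∧
      ((RSet n ω).card : ℝ) ≤ (n : ℝ) ^ (c + ε)}ᶜ ⊆
      {ω | (n : ℝ) ^ (c + ε) < (RSet n ω).card} ∪ {ω | (RSet n ω).card < (n : ℝ) ^ (c - ε)} := by
    intro ω h
    simp only [Set.mem_compl_iff, Set.mem_ofPred_eq, not_and_or, not_le, Set.mem_union] at h ⊢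
    exact h.symm
  have h3 := (measureReal_mono (μ := graphMeasure n (p n)) hc).trans (measureReal_union_le _ _)
  rw [probReal_compl_eq_one_sub (Set.toFinite _).measurableSet] at h3
  linarith
end

section
/- Suppose p = p(n) = c·(log n)/n + ξ(n) where ξ(n) = o((log n)/n) and c > 1 is a fixed constant. Then |R| = (1 − 1/c + o(1))·n asymptotically almost surely; that is, for every ε > 0, the probability that | |R|/n − (1 − 1/c) | ≤ ε tends to 1 as n → ∞. -/
open MeasureTheory Filter

/-- The vertices with index less than `k` that are reachable from vertex `0`. -/
noncomputable def reachableBelow (n k : ℕ) (ω : Fin n → Fin n → Bool) : Finset (Fin n) :=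
  open Classical in Finset.univ.filter fun j => (j : ℕ) < k ∧ Reachable n ω j

theorem mem_reachableBelow {n k : ℕ} {ω : Fin n → Fin n → Bool} {j : Fin n} :
    j ∈ reachableBelow n k ω ↔ (j : ℕ) < k ∧ Reachable n ω j := by
  simp [reachableBelow]

theorem card_reachableBelow_self (n : ℕ) (ω : Fin n → Fin n → Bool) :
    (reachableBelow n n ω).card = (RSet n ω).card := by
  rw [← Finset.card_map Fin.valEmbedding]
  congr 1
  ext j
  simp only [Finset.mem_map, mem_reachableBelow, RSet, Finset.mem_filter, Finset.mem_range,
    Fin.valEmbedding_apply]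
  constructor
  · rintro ⟨a, h, rfl⟩
    exact h
  · rintro ⟨h, h'⟩
    exact ⟨⟨j, h⟩, ⟨h, h'⟩, rfl⟩

theorem Reachable.of_agree {n k : ℕ} {ω ω' : Fin n → Fin n → Bool}
    (h : ∀ a b : Fin n, (b : ℕ) < k → ω a b = ω' a b) {j : ℕ} (hr : Reachable n ω j)
    (hj : j < k) : Reachable n ω' j := by
  induction hr with
  | refl => exact Relation.ReflTransGen.refl
  | tail _ hbc ih =>
    obtain ⟨ha, hb, hab, he⟩ := hbc
    exact (ih (hab.trans hj)).tail ⟨ha, hb, hab, (h ⟨_, ha⟩ ⟨_, hb⟩ hj) ▸ he⟩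

theorem reachableBelow_congr {n k : ℕ} {ω ω' : Fin n → Fin n → Bool}
    (h : ∀ a b : Fin n, (b : ℕ) < k → ω a b = ω' a b) :
    reachableBelow n k ω = reachableBelow n k ω' := by
  ext j
  simp only [mem_reachableBelow]
  exact ⟨fun hj => ⟨hj.1, hj.2.of_agree h hj.1⟩,
    fun hj => ⟨hj.1, hj.2.of_agree (fun a b hb => (h a b hb).symm) hj.1⟩⟩

theorem reachable_iff_exists_edge {n : ℕ} (ω : Fin n → Fin n → Bool) (k : Fin n)
    (hk : 0 < (k : ℕ)) :
    Reachable n ω k ↔ ∃ a ∈ reachableBelow n k ω, ω a k = true := by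
  constructor
  · intro h
    rcases Relation.ReflTransGen.cases_tail h with h0 | ⟨b, hb, hbn, _, hbk, he⟩
    · omega
    · exact ⟨⟨b, hbn⟩, mem_reachableBelow.2 ⟨hbk, hb⟩, he⟩
  · rintro ⟨a, ha, he⟩
    rw [mem_reachableBelow] at ha
    exact ha.2.tail ⟨a.2, k.2, ha.1, he⟩

open Classical in
theorem card_reachableBelow_succ {n : ℕ} (ω : Fin n → Fin n → Bool) (k : Fin n)
    (hk : 0 < (k : ℕ)) :
    (reachableBelow n (k + 1) ω).card =
      if ∀ a ∈ reachableBelow n k ω, ω a k = false then (reachableBelow n k ω).card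
      else (reachableBelow n k ω).card + 1 := by
  have hiff := reachable_iff_exists_edge ω k hk
  split_ifs with h
  · congr 1
    ext j
    simp only [mem_reachableBelow]
    refine ⟨fun hj => ⟨?_, hj.2⟩, fun hj => ⟨by omega, hj.2⟩⟩
    rcases Nat.lt_succ_iff_lt_or_eq.1 hj.1 with hlt | heq
    · exact hlt
    · obtain rfl : j = k := Fin.ext heq
      obtain ⟨a, ha, he⟩ := hiff.1 hj.2
      simp [h a ha] at he
  · have hr : Reachable n ω k := hiff.2 (by simpa using h)
    rw [← Finset.card_insert_of_notMem (a := k) (by simp [mem_reachableBelow])]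
    congr 1
    ext j
    simp only [Finset.mem_insert, mem_reachableBelow]
    constructor
    · rintro ⟨hj, hj'⟩
      rcases Nat.lt_succ_iff_lt_or_eq.1 hj with hlt | heq
      · exact Or.inr ⟨hlt, hj'⟩
      · exact Or.inl (Fin.ext heq)
    · rintro (rfl | hj)
      · exact ⟨by omega, hr⟩
      · exact ⟨by omega, hj.2⟩

theorem card_reachableBelow_one {n : ℕ} (hn : 0 < n) (ω : Fin n → Fin n → Bool) :
    (reachableBelow n 1 ω).card = 1 := by
  rw [Finset.card_eq_one]
  refine ⟨⟨0, hn⟩, ?_⟩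
  ext j
  simp only [mem_reachableBelow, Finset.mem_singleton, Fin.ext_iff, Nat.lt_one_iff]
  refine ⟨fun h => h.1, fun h => ⟨h, ?_⟩⟩
  rw [h]
  exact Relation.ReflTransGen.refl

theorem one_le_card_reachableBelow {n k : ℕ} (hn : 0 < n) (hk : 0 < k)
    (ω : Fin n → Fin n → Bool) : 1 ≤ (reachableBelow n k ω).card :=
  Finset.card_pos.2 ⟨⟨0, hn⟩, mem_reachableBelow.2 ⟨hk, Relation.ReflTransGen.refl⟩⟩

instance inst_s2 (n : ℕ) (p : ℝ) : IsProbabilityMeasure (graphMeasure n p) := by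
  unfold graphMeasure
  infer_instance

theorem bernMeasure_real_false {p : ℝ} (h0 : 0 ≤ p) (h1 : p ≤ 1) :
    (bernMeasure p).real {false} = 1 - p := by
  have hle : ENNReal.ofReal p ≤ 1 := by simpa using h1
  simp [bernMeasure, Measure.real, min_eq_left hle, ENNReal.toReal_sub_of_le hle, h0]

theorem iIndepFun_edge (n : ℕ) (p : ℝ) :
    ProbabilityTheory.iIndepFun
      (fun (e : Fin n × Fin n) (ω : Fin n → Fin n → Bool) => ω e.1 e.2) (graphMeasure n p) := by
  have h := ProbabilityTheory.iIndepFun_uncurry_infinitePi' (ι := Fin n) (κ := Fin n)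
    (Ω := fun _ _ => Bool) (X := fun _ _ => id) (fun _ _ => bernMeasure p)
    (fun _ _ => measurable_id)
  simp only [Measure.infinitePi_eq_pi] at h
  exact h

theorem graphMeasure_real_edge_false {n : ℕ} {p : ℝ} (h0 : 0 ≤ p) (h1 : p ≤ 1) (a b : Fin n) :
    (graphMeasure n p).real ((fun ω => ω a b) ⁻¹' {false}) = 1 - p := by
  have hmp : MeasurePreserving (fun ω : Fin n → Fin n → Bool => ω a b) (graphMeasure n p)
      (bernMeasure p) :=
    (measurePreserving_eval (fun _ : Fin n => bernMeasure p) b).comp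
      (measurePreserving_eval (fun _ : Fin n => Measure.pi fun _ : Fin n => bernMeasure p) a)
  rw [Measure.real, hmp.measure_preimage (MeasurableSet.singleton _).nullMeasurableSet]
  exact bernMeasure_real_false h0 h1

theorem graphMeasure_real_forall_edge_false {n : ℕ} {p : ℝ} (h0 : 0 ≤ p) (h1 : p ≤ 1)
    (S : Finset (Fin n)) (k : Fin n) :
    (graphMeasure n p).real {ω | ∀ a ∈ S, ω a k = false} = (1 - p) ^ S.card := by
  have hind : ProbabilityTheory.iIndepFun
      (fun (a : Fin n) (ω : Fin n → Fin n → Bool) => ω a k) (graphMeasure n p) :=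
    (iIndepFun_edge n p).precomp (g := fun a : Fin n => (a, k)) (fun a b h => by simpa using h)
  have h := hind.measure_inter_preimage_eq_mul S (sets := fun _ => {false})
    (fun _ _ => MeasurableSet.singleton _)
  have hset : {ω : Fin n → Fin n → Bool | ∀ a ∈ S, ω a k = false} =
      ⋂ a ∈ S, (fun ω : Fin n → Fin n → Bool => ω a k) ⁻¹' {false} := by
    ext ω
    simp
  rw [hset, Measure.real, h, ENNReal.toReal_prod, ← Finset.prod_const]
  exact Finset.prod_congr rfl fun a _ => graphMeasure_real_edge_false h0 h1 a k

theorem graphMeasure_real_reachableBelow_inter {n : ℕ} {p : ℝ} (h0 : 0 ≤ p) (h1 : p ≤ 1)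
    (S : Finset (Fin n)) (k : Fin n) :
    (graphMeasure n p).real ({ω | reachableBelow n k ω = S} ∩ {ω | ∀ a ∈ S, ω a k = false}) =
      (graphMeasure n p).real {ω | reachableBelow n k ω = S} * (1 - p) ^ S.card := by
  classical
  let T : Finset (Fin n × Fin n) := Finset.univ.filter fun e => (e.2 : ℕ) < k
  let U : Finset (Fin n × Fin n) := Finset.univ.filter fun e => e.2 = k
  have hTU : Disjoint T U := by
    rw [Finset.disjoint_filter]
    rintro e _ h rfl
    exact lt_irrefl _ h
  have hind := (iIndepFun_edge n p).indepFun_finset T U hTU (fun e => by fun_prop)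
  let extend : (T → Bool) → Fin n → Fin n → Bool :=
    fun g a b => if h : (a, b) ∈ T then g ⟨(a, b), h⟩ else false
  have h := hind.measure_inter_preimage_eq_mul
    {g | reachableBelow n k (extend g) = S}
    {g | ∀ a (ha : a ∈ S), g ⟨(a, k), by simp [U]⟩ = false}
    (Set.toFinite _).measurableSet (Set.toFinite _).measurableSet
  have hT : {ω | reachableBelow n k ω = S} =
      (fun (ω : Fin n → Fin n → Bool) (e : T) => ω e.1.1 e.1.2) ⁻¹'
        {g | reachableBelow n k (extend g) = S} := by
    ext ω
    simp only [Set.mem_ofPred_eq, Set.mem_preimage]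
    rw [reachableBelow_congr (ω' := extend fun e : T => ω e.1.1 e.1.2)]
    intro a b hb
    simp [extend, T, Fin.lt_def.2 hb]
  have hU : {ω : Fin n → Fin n → Bool | ∀ a ∈ S, ω a k = false} =
      (fun (ω : Fin n → Fin n → Bool) (e : U) => ω e.1.1 e.1.2) ⁻¹'
        {g | ∀ a (ha : a ∈ S), g ⟨(a, k), by simp [U]⟩ = false} := rfl
  rw [← graphMeasure_real_forall_edge_false h0 h1 S k, Measure.real, Measure.real, Measure.real,
    ← ENNReal.toReal_mul, hU, hT, h]

theorem integral_comp_card_reachableBelow_succ {n : ℕ} {p : ℝ} (h0 : 0 ≤ p) (h1 : p ≤ 1)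
    (k : Fin n) (hk : 0 < (k : ℕ)) (φ : ℕ → ℝ) :
    ∫ ω, φ (reachableBelow n (k + 1) ω).card ∂graphMeasure n p =
      ∫ ω, ((1 - p) ^ (reachableBelow n k ω).card * φ (reachableBelow n k ω).card +
        (1 - (1 - p) ^ (reachableBelow n k ω).card) * φ ((reachableBelow n k ω).card + 1))
          ∂graphMeasure n p := by
  classical
  have hm : ∀ s : Set (Fin n → Fin n → Bool), MeasurableSet s :=
    fun s => (Set.toFinite s).measurableSet
  have hL : ∀ ω, φ (reachableBelow n (k + 1) ω).card = ∑ S : Finset (Fin n),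
      ({ω | reachableBelow n k ω = S}.indicator (fun _ => φ (S.card + 1)) ω +
        ({ω | reachableBelow n k ω = S} ∩ {ω | ∀ a ∈ S, ω a k = false}).indicator
          (fun _ => φ S.card - φ (S.card + 1)) ω) := by
    intro ω
    rw [Finset.sum_eq_single (reachableBelow n k ω), card_reachableBelow_succ ω k hk]
    · simp only [Set.indicator_apply, Set.mem_inter_iff, Set.mem_ofPred_eq, true_and, if_true]
      split_ifs <;> ring
    · intro S _ hS
      simp [hS.symm]
    · simp
  have hR : ∀ ω, (1 - p) ^ (reachableBelow n k ω).card * φ (reachableBelow n k ω).card +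
        (1 - (1 - p) ^ (reachableBelow n k ω).card) * φ ((reachableBelow n k ω).card + 1) =
      ∑ S : Finset (Fin n), {ω | reachableBelow n k ω = S}.indicator
        (fun _ => (1 - p) ^ S.card * φ S.card + (1 - (1 - p) ^ S.card) * φ (S.card + 1)) ω := by
    intro ω
    rw [Finset.sum_eq_single (reachableBelow n k ω)]
    · simp
    · intro S _ hS
      simp [hS.symm]
    · simp
  simp_rw [hL, hR]
  rw [integral_finsetSum _ fun _ _ => Integrable.of_finite,
    integral_finsetSum _ fun _ _ => Integrable.of_finite]
  refine Finset.sum_congr rfl fun S _ => ?_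
  rw [integral_add Integrable.of_finite Integrable.of_finite, integral_indicator_const _ (hm _),
    integral_indicator_const _ (hm _), integral_indicator_const _ (hm _),
    graphMeasure_real_reachableBelow_inter h0 h1]
  simp only [smul_eq_mul]
  ring

/-- The expected number of steps in which a chain started at `1`, moving from `x` to `x + 1` with
probability `1 - (1 - p) ^ x`, grows to `m`. -/
noncomputable def meanGrowthTime (p : ℝ) (m : ℕ) : ℝ :=
  ∑ j ∈ Finset.range (m - 1), 1 / (1 - (1 - p) ^ (j + 1))

theorem meanGrowthTime_succ (p : ℝ) {m : ℕ} (hm : 1 ≤ m) :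
    meanGrowthTime p (m + 1) = meanGrowthTime p m + 1 / (1 - (1 - p) ^ m) := by
  obtain ⟨m, rfl⟩ := Nat.exists_eq_add_of_le' hm
  simp [meanGrowthTime, Finset.sum_range_succ]

theorem one_sub_one_sub_pow_pos {p : ℝ} (h0 : 0 < p) (h1 : p ≤ 1) (m : ℕ) :
    0 < 1 - (1 - p) ^ (m + 1) :=
  sub_pos.2 (pow_lt_one₀ (by linarith) (by linarith) m.succ_ne_zero)

theorem one_div_one_sub_one_sub_pow_le {p : ℝ} (h0 : 0 < p) (h1 : p ≤ 1) (j : ℕ) :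
    1 / (1 - (1 - p) ^ (j + 1)) ≤ 1 + ((j + 1 : ℕ) : ℝ)⁻¹ / p := by
  have hpos := one_sub_one_sub_pow_pos h0 h1 j
  have hq : (1 - p) ^ (j + 1) * (1 + (j + 1 : ℕ) * p) ≤ 1 := by
    have hb := one_add_mul_le_pow (a := p) (by linarith) (j + 1)
    calc (1 - p) ^ (j + 1) * (1 + (j + 1 : ℕ) * p)
        ≤ (1 - p) ^ (j + 1) * (1 + p) ^ (j + 1) :=
          mul_le_mul_of_nonneg_left hb (pow_nonneg (by linarith) _)
      _ = (1 - p ^ 2) ^ (j + 1) := by rw [← mul_pow]; ring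
      _ ≤ 1 := pow_le_one₀ (by nlinarith) (by nlinarith)
  have hj : (0 : ℝ) < (j + 1 : ℕ) := by positivity
  rw [div_le_iff₀ hpos]
  have : 1 + ((j + 1 : ℕ) : ℝ)⁻¹ / p = (1 + (j + 1 : ℕ) * p) / ((j + 1 : ℕ) * p) := by
    field_simp
    ring
  rw [this, div_mul_eq_mul_div, le_div_iff₀ (by positivity)]
  linarith

theorem inv_div_le_one_div_one_sub_one_sub_pow {p : ℝ} (h0 : 0 < p) (h1 : p ≤ 1) (j : ℕ) :
    ((j + 1 : ℕ) : ℝ)⁻¹ / p ≤ 1 / (1 - (1 - p) ^ (j + 1)) := by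
  have hpos := one_sub_one_sub_pow_pos h0 h1 j
  have hb := one_add_mul_le_pow (a := -p) (by linarith) (j + 1)
  rw [← sub_eq_add_neg] at hb
  have : ((j + 1 : ℕ) : ℝ)⁻¹ / p = 1 / ((j + 1 : ℕ) * p) := by
    field_simp
  rw [this]
  exact one_div_le_one_div_of_le hpos (by linarith)

theorem one_le_one_div_one_sub_one_sub_pow {p : ℝ} (h0 : 0 < p) (h1 : p ≤ 1) (j : ℕ) :
    1 ≤ 1 / (1 - (1 - p) ^ (j + 1)) := by
  rw [le_div_iff₀ (one_sub_one_sub_pow_pos h0 h1 j)]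
  linarith [pow_nonneg (sub_nonneg.2 h1) (j + 1)]

theorem meanGrowthTime_le {p : ℝ} (h0 : 0 < p) (h1 : p ≤ 1) {m n : ℕ} (hm : 1 ≤ m)
    (hmn : m ≤ n) : meanGrowthTime p m ≤ m + (1 + Real.log n) / p := by
  obtain ⟨m, rfl⟩ := Nat.exists_eq_add_of_le' hm
  have hlog : (harmonic m : ℝ) ≤ 1 + Real.log n := by
    refine (harmonic_le_one_add_log m).trans (add_le_add_right ?_ 1)
    rcases Nat.eq_zero_or_pos m with rfl | hm0
    · simpa using Real.log_natCast_nonneg n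
    · exact Real.log_le_log (by exact_mod_cast hm0) (by exact_mod_cast (by omega : m ≤ n))
  calc meanGrowthTime p (m + 1)
      ≤ ∑ j ∈ Finset.range m, (1 + ((j + 1 : ℕ) : ℝ)⁻¹ / p) :=
        Finset.sum_le_sum fun j _ => one_div_one_sub_one_sub_pow_le h0 h1 j
    _ = m + harmonic m / p := by
        simp [Finset.sum_add_distrib, ← Finset.sum_div, harmonic]
    _ ≤ (m + 1 : ℕ) + (1 + Real.log n) / p := by
        gcongr
        exact m.le_succ

theorem le_meanGrowthTime {p : ℝ} (h0 : 0 < p) (h1 : p ≤ 1) {J m : ℕ} (hJ : 1 ≤ J)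
    (hJm : J ≤ m) : m - J + Real.log J / p ≤ meanGrowthTime p m := by
  induction m, hJm using Nat.le_induction with
  | base =>
    obtain ⟨J, rfl⟩ := Nat.exists_eq_add_of_le' hJ
    calc ((J + 1 : ℕ) : ℝ) - (J + 1 : ℕ) + Real.log (J + 1 : ℕ) / p
        ≤ harmonic J / p := by
          rw [sub_self, zero_add]
          exact div_le_div_of_nonneg_right (log_add_one_le_harmonic J) h0.le
      _ = ∑ j ∈ Finset.range J, ((j + 1 : ℕ) : ℝ)⁻¹ / p := by
          simp [← Finset.sum_div, harmonic]
      _ ≤ meanGrowthTime p (J + 1) :=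
          Finset.sum_le_sum fun j _ => inv_div_le_one_div_one_sub_one_sub_pow h0 h1 j
  | succ m hm ih =>
    have h := one_le_one_div_one_sub_one_sub_pow h0 h1 (m - 1)
    rw [Nat.sub_add_cancel (hJ.trans hm)] at h
    rw [meanGrowthTime_succ p (hJ.trans hm)]
    push_cast
    linarith

theorem integral_sq_meanGrowthTime_sub_le {n : ℕ} {p : ℝ} (h0 : 0 < p) (h1 : p ≤ 1) {k : ℕ}
    (hk : 1 ≤ k) (hkn : k ≤ n) :
    ∫ ω, (meanGrowthTime p (reachableBelow n k ω).card - k) ^ 2 ∂graphMeasure n p ≤ k / p := by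
  have hn : 0 < n := hk.trans hkn
  induction k, hk using Nat.le_induction with
  | base =>
    simp only [card_reachableBelow_one hn]
    simpa [meanGrowthTime] using (one_le_inv₀ h0).2 h1
  | succ k hk ih =>
    have hrec := integral_comp_card_reachableBelow_succ h0.le h1 (⟨k, hkn⟩ : Fin n) hk
      (fun x => (meanGrowthTime p x - (k + 1 : ℕ)) ^ 2)
    simp only at hrec
    rw [hrec]
    calc _ ≤ ∫ ω, ((meanGrowthTime p (reachableBelow n k ω).card - k) ^ 2 + 1 / p)
          ∂graphMeasure n p := by
          refine integral_mono Integrable.of_finite Integrable.of_finite fun ω => ?_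
          have hX := one_le_card_reachableBelow hn hk ω
          beta_reduce
          generalize (reachableBelow n k ω).card = x at hX
          obtain ⟨x, rfl⟩ := Nat.exists_eq_add_of_le' hX
          have hpos := one_sub_one_sub_pow_pos h0 h1 x
          have hle : 1 / (1 - (1 - p) ^ (x + 1)) ≤ 1 / p := by
            refine one_div_le_one_div_of_le h0 ?_
            have := pow_le_of_le_one (sub_nonneg.2 h1) (by linarith) (Nat.add_one_ne_zero x)
            linarith
          rw [meanGrowthTime_succ p hX]
          push_cast
          generalize meanGrowthTime p (x + 1) = f
          generalize (1 - p) ^ (x + 1) = q at hpos hle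
          have key : q * (f - (k + 1)) ^ 2 + (1 - q) * (f + 1 / (1 - q) - (k + 1)) ^ 2 =
              (f - k) ^ 2 - 1 + 1 / (1 - q) := by
            field_simp
            ring
          rw [key]
          linarith
      _ = (∫ ω, (meanGrowthTime p (reachableBelow n k ω).card - k) ^ 2 ∂graphMeasure n p) +
            1 / p := by
          rw [integral_add Integrable.of_finite Integrable.of_finite]
          simp
      _ ≤ k / p + 1 / p := by
          gcongr
          exact ih (by omega)
      _ = (k + 1 : ℕ) / p := by
          push_cast
          ring

theorem graphMeasure_real_meanGrowthTime_le {n : ℕ} {p δ : ℝ} (h0 : 0 < p) (h1 : p ≤ 1)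
    (hn : 1 ≤ n) (hδ : 0 < δ) :
    (graphMeasure n p).real {ω | δ * n ≤ |meanGrowthTime p (RSet n ω).card - n|} ≤
      1 / (δ ^ 2 * (n * p)) := by
  have hn' : (0 : ℝ) < n := by exact_mod_cast hn
  have hmarkov := mul_meas_ge_le_integral_of_nonneg (μ := graphMeasure n p)
    (f := fun ω => (meanGrowthTime p (RSet n ω).card - n) ^ 2)
    (ae_of_all _ fun ω => sq_nonneg _) Integrable.of_finite ((δ * n) ^ 2)
  have hvar := integral_sq_meanGrowthTime_sub_le h0 h1 hn le_rfl
  simp only [card_reachableBelow_self] at hvar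
  have hset : {ω | δ * n ≤ |meanGrowthTime p (RSet n ω).card - n|} =
      {ω | (δ * n) ^ 2 ≤ (meanGrowthTime p (RSet n ω).card - n) ^ 2} := by
    ext ω
    simp only [Set.mem_ofPred_eq]
    rw [sq_le_sq, abs_of_pos (by positivity : 0 < δ * n)]
  rw [hset]
  have hfin := hmarkov.trans hvar
  rw [mul_comm, ← le_div_iff₀ (by positivity)] at hfin
  refine hfin.trans (le_of_eq ?_)
  field_simp

theorem abs_card_div_sub_le {n x : ℕ} {p c δ ε : ℝ} (h0 : 0 < p) (h1 : p ≤ 1) (hc : 1 < c)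
    (hδ : 0 < δ) (hδε : 8 * δ ≤ ε) (hx : 1 ≤ x) (hxn : x ≤ n)
    (hupper : (1 + Real.log n) / p ≤ (1 / c + δ) * n)
    (hlower : (1 / c - δ) * n ≤ (Real.log (ε / 2) + Real.log n) / p)
    (hone : 1 ≤ δ * n) (hdev : |meanGrowthTime p x - n| < δ * n) :
    |(x : ℝ) / n - (1 - 1 / c)| ≤ ε := by
  have hn : (0 : ℝ) < n := by exact_mod_cast hx.trans hxn
  have hε : 0 < ε := by linarith
  have hc1 : 1 / c < 1 := by rw [div_lt_one] <;> linarith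
  rw [abs_lt] at hdev
  rw [abs_le]
  constructor
  · have hf := meanGrowthTime_le h0 h1 hx hxn
    have : 1 - 1 / c - ε ≤ (x : ℝ) / n := by
      rw [le_div_iff₀ hn]
      nlinarith
    linarith
  · by_contra! hlt
    have hxlt : (1 - 1 / c + ε) * n < x := by
      rw [← lt_div_iff₀ hn]
      linarith
    have hpos : 0 < ε / 2 * n := by positivity
    have hJx : ⌈ε / 2 * n⌉₊ ≤ x := Nat.ceil_le.2 (by nlinarith)
    have hf := le_meanGrowthTime h0 h1 (Nat.one_le_ceil_iff.2 hpos) hJx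
    have hlog : (Real.log (ε / 2) + Real.log n) / p ≤ Real.log ⌈ε / 2 * n⌉₊ / p := by
      rw [← Real.log_mul (by positivity) hn.ne']
      exact div_le_div_of_nonneg_right (Real.log_le_log hpos (Nat.le_ceil _)) h0.le
    have hceil := Nat.ceil_lt_add_one hpos.le
    nlinarith

open Asymptotics in
theorem tendsto_mul_div_log {c : ℝ} {p ξ : ℕ → ℝ}
    (hξ : ξ =o[atTop] fun n : ℕ => Real.log n / n)
    (hp : ∀ n : ℕ, p n = c * Real.log n / n + ξ n) :
    Tendsto (fun n : ℕ => n * p n / Real.log n) atTop (nhds c) := by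
  have h := (hξ.tendsto_div_nhds_zero).const_add c
  rw [add_zero] at h
  refine h.congr' ?_
  filter_upwards [eventually_gt_atTop 1] with n hn
  have hn0 : (n : ℝ) ≠ 0 := by positivity
  have hlog : Real.log n ≠ 0 := (Real.log_pos (by exact_mod_cast hn)).ne'
  rw [hp]
  field_simp

theorem tendsto_const_add_log_div {c : ℝ} (hc : 0 < c) {p : ℕ → ℝ}
    (hp : Tendsto (fun n : ℕ => n * p n / Real.log n) atTop (nhds c)) (a : ℝ) :
    Tendsto (fun n : ℕ => (a + Real.log n) / (n * p n)) atTop (nhds (1 / c)) := by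
  have hlog : Tendsto (fun n : ℕ => Real.log n) atTop atTop :=
    Real.tendsto_log_atTop.comp tendsto_natCast_atTop_atTop
  have h := ((hlog.const_div_atTop a).add_const 1).div hp hc.ne'
  rw [zero_add] at h
  refine h.congr' ?_
  filter_upwards [hlog.eventually_gt_atTop 0] with n hn
  simp only [Pi.div_apply]
  field_simp

theorem tendsto_mul_atTop {c : ℝ} (hc : 0 < c) {p : ℕ → ℝ}
    (hp : Tendsto (fun n : ℕ => n * p n / Real.log n) atTop (nhds c)) :
    Tendsto (fun n : ℕ => n * p n) atTop atTop := by
  have hlog : Tendsto (fun n : ℕ => Real.log n) atTop atTop :=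
    Real.tendsto_log_atTop.comp tendsto_natCast_atTop_atTop
  refine (hp.pos_mul_atTop hc hlog).congr' ?_
  filter_upwards [hlog.eventually_gt_atTop 0] with n hn
  field_simp

theorem tendsto_edge_probability_zero {c : ℝ} {p : ℕ → ℝ}
    (hp : Tendsto (fun n : ℕ => n * p n / Real.log n) atTop (nhds c)) :
    Tendsto p atTop (nhds 0) := by
  have hlog : Tendsto (fun n : ℕ => Real.log n / n) atTop (nhds 0) :=
    (Real.isLittleO_log_id_atTop.tendsto_div_nhds_zero).comp tendsto_natCast_atTop_atTop
  have h := hp.mul hlog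
  rw [mul_zero] at h
  refine h.congr' ?_
  filter_upwards [eventually_gt_atTop 1] with n hn
  have hn0 : (n : ℝ) ≠ 0 := by positivity
  have hlog : Real.log n ≠ 0 := (Real.log_pos (by exact_mod_cast hn)).ne'
  field_simp

open Asymptotics in
/-- If `p n = c·(log n)/n + ξ n` with `ξ = o((log n)/n)` and `c > 1` fixed,
then `|R| = (1 - 1/c + o(1))·n` a.a.s.: for every `ε > 0`, the probability that
`| |R|/n − (1 − 1/c) | ≤ ε` tends to `1` as `n → ∞`. -/
theorem reachable_card_aas_of_gt_one (c : ℝ) (hc : 1 < c) (p ξ : ℕ → ℝ)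
    (hξ : ξ =o[atTop] fun n : ℕ => Real.log n / n)
    (hp : ∀ n : ℕ, p n = c * Real.log n / n + ξ n)
    (ε : ℝ) (hε : 0 < ε) :
    Tendsto (fun n : ℕ => graphMeasure n (p n)
        {ω | |((RSet n ω).card : ℝ) / n - (1 - 1 / c)| ≤ ε})
      atTop (nhds 1) := by
  have hc0 : 0 < c := by linarith
  have hr := tendsto_mul_div_log hξ hp
  have hnp := tendsto_mul_atTop hc0 hr
  obtain ⟨δ, hδ, hδε⟩ : ∃ δ : ℝ, 0 < δ ∧ 8 * δ ≤ ε := ⟨ε / 8, by linarith, by linarith⟩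
  have hbound : ∀ᶠ n : ℕ in atTop, 1 - 1 / (δ ^ 2 * (n * p n)) ≤
      (graphMeasure n (p n)).real {ω | |((RSet n ω).card : ℝ) / n - (1 - 1 / c)| ≤ ε} := by
    filter_upwards [hnp.eventually_gt_atTop 0, eventually_ge_atTop 1,
      (tendsto_edge_probability_zero hr).eventually_le_const one_pos,
      (tendsto_const_add_log_div hc0 hr 1).eventually_le_const
        (by linarith : 1 / c < 1 / c + δ),
      (tendsto_const_add_log_div hc0 hr (Real.log (ε / 2))).eventually_const_le
        (by linarith : 1 / c - δ < 1 / c),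
      (tendsto_natCast_atTop_atTop.const_mul_atTop hδ).eventually_ge_atTop 1]
      with n hpos hn hp1 hupper hlower hone
    have hn' : (0 : ℝ) < n := by exact_mod_cast hn
    have hp0 : 0 < p n := pos_of_mul_pos_right hpos hn'.le
    rw [mul_comm, ← div_div, div_le_iff₀ hn'] at hupper
    rw [mul_comm (n : ℝ), ← div_div, le_div_iff₀ hn'] at hlower
    have hcompl : {ω | |((RSet n ω).card : ℝ) / n - (1 - 1 / c)| ≤ ε}ᶜ ⊆
        {ω | δ * n ≤ |meanGrowthTime (p n) (RSet n ω).card - n|} := by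
      intro ω hω
      by_contra hdev
      refine hω (abs_card_div_sub_le hp0 hp1 hc hδ hδε ?_ ?_ hupper hlower hone (not_le.1 hdev))
      · rw [← card_reachableBelow_self]
        exact one_le_card_reachableBelow hn hn ω
      · rw [← card_reachableBelow_self]
        exact card_finset_fin_le _
    have hle := (measureReal_mono (μ := graphMeasure n (p n)) hcompl).trans
      (graphMeasure_real_meanGrowthTime_le hp0 hp1 hn hδ)
    rw [probReal_compl_eq_one_sub (Set.toFinite _).measurableSet] at hle
    linarith
  have hlim : Tendsto (fun n : ℕ => 1 - 1 / (δ ^ 2 * (n * p n))) atTop (nhds 1) := by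
    simpa using ((hnp.const_mul_atTop (pow_pos hδ 2)).const_div_atTop 1).const_sub 1
  have hreal := tendsto_of_tendsto_of_tendsto_of_le_of_le' hlim tendsto_const_nhds hbound
    (Eventually.of_forall fun n => measureReal_le_one)
  rw [← ENNReal.tendsto_toReal_iff (fun n => measure_ne_top _ _) ENNReal.one_ne_top]
  exact hreal
end
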